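/- (Critical payment property of TBSAP) Fix all vehicles' task sets and all bids of vehicles other than v_i. If v_i is a winner with payment p_i computed by the TBSAP payment stage, then for any bid b°_i > p_i (others' bids unchanged), v_i is not in the winner set output by the TBSAP winner allocation stage; that is, p_i is the maximum bid with which v_i can win. -/

import Mathlib

/-- Total appraisement of the tasks covered by the vehicle set `W`:
`A(W) = Σ_{t ∈ ⋃_{i∈W} T_i} a_t`. -/
noncomputable def Aval {V T : Type} [DecidableEq T]
    (a : T → ℝ) (Ts : V → Finset T) (W : Finset V) : ℝ :=
  ∑ t ∈ W.biUnion Ts, a t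

/-- Profit-at-bids: `P̄(W) = A(W) − Σ_{i∈W} b_i`. -/
noncomputable def Pbar {V T : Type} [DecidableEq T]
    (a : T → ℝ) (Ts : V → Finset T) (b : V → ℝ) (W : Finset V) : ℝ :=
  Aval a Ts W - ∑ i ∈ W, b i

/-- Marginal coverage value `A(v|W) = A(W ∪ {v}) − A(W)`. -/
noncomputable def margA {V T : Type} [DecidableEq V] [DecidableEq T]
    (a : T → ℝ) (Ts : V → Finset T) (v : V) (W : Finset V) : ℝ :=
  Aval a Ts (insert v W) - Aval a Ts W

/-- Marginal profit-at-bids `P̄(v|W) = P̄(W ∪ {v}) − P̄(W)`. -/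
noncomputable def margP {V T : Type} [DecidableEq V] [DecidableEq T]
    (a : T → ℝ) (Ts : V → Finset T) (b : V → ℝ) (v : V) (W : Finset V) : ℝ :=
  Pbar a Ts b (insert v W) - Pbar a Ts b W

/-- Pick an element of `F` maximizing `f` (with a fixed tie-breaking rule). -/
noncomputable def pickMax {V : Type} (f : V → ℝ) (F : Finset V) : Option V :=
  if h : F.Nonempty then some (F.exists_max_image f h).choose else none

/-- Unit marginal gain `P̂(v|W) = P̄(v|W)/b_v`. -/
noncomputable def unitGain {V T : Type} [DecidableEq V] [DecidableEq T]
    (a : T → ℝ) (Ts : V → Finset T) (b : V → ℝ) (v : V) (W : Finset V) : ℝ :=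
  margP a Ts b v W / b v

/-- Generic fuel-based greedy selection used by both TBSAP stages: from ground set
`G`, with budget `B`, accumulated spending `s` and current selection list `X`
(in selection order), repeatedly select `v* ∈ G ∖ X` maximizing `P̂(v|X)`; stop
if `P̂(v*|X) < 0` or `s + extra v* > B`, otherwise append `v*` to `X` and add
`b_{v*}` to `s`.  The winner allocation stage uses `extra = b`; the payment stage
for vehicle `i` uses `extra = const (b i)`. -/
noncomputable def tbsapSel {V T : Type} [DecidableEq V] [DecidableEq T]
    (a : T → ℝ) (Ts : V → Finset T) (b : V → ℝ) (B : ℝ) (extra : V → ℝ)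
    (G : Finset V) : ℕ → List V → ℝ → List V
  | 0, X, _ => X
  | n+1, X, s =>
    match pickMax (fun v => unitGain a Ts b v X.toFinset) (G \ X.toFinset) with
    | none => X
    | some v =>
      if unitGain a Ts b v X.toFinset < 0 ∨ B < s + extra v then X
      else tbsapSel a Ts b B extra G n (X ++ [v]) (s + b v)

/-- TBSAP winner allocation stage: the output `X_L = [v₁, …, v_L]` in selection
order; `(tbsapWinners …).take j` (as a finset) is `X_j`. -/
noncomputable def tbsapWinners {V T : Type} [Fintype V] [DecidableEq V] [DecidableEq T]
    (a : T → ℝ) (Ts : V → Finset T) (b : V → ℝ) (B : ℝ) : List V :=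
  tbsapSel a Ts b B b Finset.univ (Fintype.card V) [] 0

/-- TBSAP payment-stage greedy over `V₋ᵢ = V ∖ {i}`: produces
`[v_{i_1}, …, v_{i_{L_i}}]`, stopping at the largest `L_i` with
`P̂(v_{i_{L_i}}|Y_{L_i−1}) ≥ 0` and `Σ_{j≤L_i−1} b_{i_j} + b_i ≤ B`. -/
noncomputable def tbsapPaymentList {V T : Type} [Fintype V] [DecidableEq V] [DecidableEq T]
    (a : T → ℝ) (Ts : V → Finset T) (b : V → ℝ) (B : ℝ) (i : V) : List V :=
  tbsapSel a Ts b B (fun _ => b i) (Finset.univ.erase i) (Fintype.card V) [] 0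

/-- The candidate replacement bids `b_{i_j} · A(v_i|Y_{j−1}) / A(v_{i_j}|Y_{j−1})`
for `j = 1, …, L_i` along the payment-stage list. -/
noncomputable def candList {V T : Type} [DecidableEq V] [DecidableEq T]
    (a : T → ℝ) (Ts : V → Finset T) (b : V → ℝ) (i : V) :
    List V → Finset V → List ℝ
  | [], _ => []
  | v :: rest, Y =>
    (b v * margA a Ts i Y / margA a Ts v Y) :: candList a Ts b i rest (insert v Y)

/-- The TBSAP payment for vehicle `i`:
`p_i = max_{1≤j≤L_i} b_{i_j}·A(v_i|Y_{j−1})/A(v_{i_j}|Y_{j−1})`, additionally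
compared with `A(v_i|Y_{L_i})` when `Σ_{j≤L_i} b_{i_j} + b_i ≤ B`.  (All the
compared quantities are nonnegative, so folding `max` from `0` over the
candidate list realizes exactly this maximum.) -/
noncomputable def tbsapPayment {V T : Type} [Fintype V] [DecidableEq V] [DecidableEq T]
    (a : T → ℝ) (Ts : V → Finset T) (b : V → ℝ) (B : ℝ) (i : V) : ℝ :=
  let Y := tbsapPaymentList a Ts b B i
  let cands := candList a Ts b i Y ∅
  let cands' := if (Y.map b).sum + b i ≤ B then margA a Ts i Y.toFinset :: cands else cands
  cands'.foldr max 0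

theorem pickMax_some {V : Type} {f : V → ℝ} {F : Finset V} {v : V}
    (h : pickMax f F = some v) : v ∈ F ∧ ∀ y ∈ F, f y ≤ f v := by
  unfold pickMax at h
  split_ifs at h with hF
  have := (F.exists_max_image f hF).choose_spec
  simp only [Option.some.injEq] at h
  rw [h] at this
  exact this

theorem pickMax_none {V : Type} {f : V → ℝ} {F : Finset V}
    (h : pickMax f F = none) : F = ∅ := by
  unfold pickMax at h
  split_ifs at h with hF
  exact Finset.not_nonempty_iff_eq_empty.mp hF

theorem pickMax_congr {V : Type} {f g : V → ℝ} {F G : Finset V}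
    (hFG : F.Nonempty ↔ G.Nonempty)
    (h : ∀ x, (x ∈ F ∧ ∀ y ∈ F, f y ≤ f x) ↔ (x ∈ G ∧ ∀ y ∈ G, g y ≤ g x)) :
    pickMax f F = pickMax g G := by
  unfold pickMax
  by_cases hF : F.Nonempty
  · have hG := hFG.mp hF
    rw [dif_pos hF, dif_pos hG]
    have hp : (fun x => x ∈ F ∧ ∀ y ∈ F, f y ≤ f x) = (fun x => x ∈ G ∧ ∀ y ∈ G, g y ≤ g x) :=
      funext fun x => propext (h x)
    congr 1
    have key : ∀ (p q : V → Prop) (hp : ∃ x, p x) (hq : ∃ x, q x), p = q →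
        hp.choose = hq.choose := by
      intro p q hp hq e
      subst e
      rfl
    exact key _ _ _ _ hp
  · have hG := fun h => hF (hFG.mpr h)
    rw [dif_neg hF, dif_neg hG]

theorem pickMax_erase {V : Type} [Fintype V] [DecidableEq V] {f g : V → ℝ} {i : V}
    (X : Finset V) (hfg : ∀ y, y ∉ X → y ≠ i → f y = g y)
    (w : V) (hw : w ∉ X) (hlt : f i < f w) :
    pickMax f (Finset.univ \ X) = pickMax g (Finset.univ.erase i \ X) := by
  have hwi : w ≠ i := by
    rintro rfl
    exact lt_irrefl _ hlt
  apply pickMax_congr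
  · constructor
    · intro _
      exact ⟨w, by simp [hw, hwi]⟩
    · intro _
      exact ⟨w, by simp [hw]⟩
  · intro x
    simp only [Finset.mem_sdiff, Finset.mem_univ, true_and, Finset.mem_erase, and_true]
    constructor
    · rintro ⟨hx, hm⟩
      have hxi : x ≠ i := by
        rintro rfl
        exact absurd (hm w hw) (not_le.mpr hlt)
      refine ⟨⟨hxi, hx⟩, ?_⟩
      rintro y ⟨hyi, hy⟩
      rw [← hfg y hy hyi, ← hfg x hx hxi]
      exact hm y hy
    · rintro ⟨⟨hxi, hx⟩, hm⟩
      have h1 : ∀ y, y ∉ X → y ≠ i → f y ≤ f x := by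
        intro y hy hyi
        rw [hfg y hy hyi, hfg x hx hxi]
        exact hm y ⟨hyi, hy⟩
      refine ⟨hx, fun y hy => ?_⟩
      by_cases hyi : y = i
      · rw [hyi]
        exact hlt.le.trans (h1 w hw hwi)
      · exact h1 y hy hyi

section
variable {V T : Type} [DecidableEq V] [DecidableEq T]

theorem unitGain_eq (a : T → ℝ) (Ts : V → Finset T) (b : V → ℝ) (v : V) (W : Finset V)
    (hv : v ∉ W) : unitGain a Ts b v W = (margA a Ts v W - b v) / b v := by
  unfold unitGain margP Pbar margA
  rw [Finset.sum_insert hv]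
  congr 1
  ring

theorem unitGain_nonneg (a : T → ℝ) (Ts : V → Finset T) (b : V → ℝ) (v : V) (W : Finset V)
    (hv : v ∉ W) (hb : 0 < b v) : 0 ≤ unitGain a Ts b v W ↔ b v ≤ margA a Ts v W := by
  rw [unitGain_eq a Ts b v W hv, le_div_iff₀ hb]
  constructor <;> intro h <;> linarith

theorem sel_prefix (a : T → ℝ) (Ts : V → Finset T) (b : V → ℝ) (B : ℝ) (e : V → ℝ)
    (G : Finset V) (n : ℕ) : ∀ (X : List V) (s : ℝ),
    ∃ R, tbsapSel a Ts b B e G n X s = X ++ R := by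
  induction n with
  | zero => intro X s; exact ⟨[], by simp [tbsapSel]⟩
  | succ n ih =>
    intro X s
    unfold tbsapSel
    split
    · exact ⟨[], by simp⟩
    · rename_i v _
      split_ifs
      · exact ⟨[], by simp⟩
      · obtain ⟨R, hR⟩ := ih (X ++ [v]) (s + b v)
        exact ⟨v :: R, by rw [hR]; simp⟩

theorem sel_budget (a : T → ℝ) (Ts : V → Finset T) (b : V → ℝ) (B : ℝ)
    (hb : ∀ v, 0 < b v) (i : V)
    (G : Finset V) (n : ℕ) : ∀ (X : List V) (s : ℝ), i ∉ X →
    i ∈ tbsapSel a Ts b B b G n X s → s + b i ≤ B := by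
  induction n with
  | zero => intro X s hX h; exact absurd h hX
  | succ n ih =>
    intro X s hX h
    unfold tbsapSel at h
    split at h
    · exact absurd h hX
    · rename_i v _
      split_ifs at h with hc
      · exact absurd h hX
      · push Not at hc
        by_cases hv : i = v
        · rw [hv]; exact hc.2
        · have := ih (X ++ [v]) (s + b v) (by simp [hX, hv]) h
          linarith [hb v]

theorem cand_mem (a : T → ℝ) (Ts : V → Finset T) (b : V → ℝ) (i v : V) (R : List V) :
    ∀ (X : List V) (Y : Finset V),
    b v * margA a Ts i (Y ∪ X.toFinset) / margA a Ts v (Y ∪ X.toFinset)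
      ∈ candList a Ts b i (X ++ v :: R) Y := by
  intro X
  induction X with
  | nil => intro Y; simp [candList]
  | cons x X ih =>
    intro Y
    have := ih (insert x Y)
    have e : insert x Y ∪ X.toFinset = Y ∪ (x :: X).toFinset := by
      ext z; simp
    rw [e] at this
    simp only [List.cons_append, candList]
    exact List.mem_cons_of_mem _ this

theorem le_foldr_max (l : List ℝ) (c : ℝ) (h : c ∈ l) : c ≤ l.foldr max 0 := by
  induction l with
  | nil => simp at h
  | cons x l ih =>
    simp only [List.foldr_cons]
    rcases List.mem_cons.mp h with rfl | h
    · exact le_max_left _ _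
    · exact (ih h).trans (le_max_right _ _)

theorem foldr_max_nonneg (l : List ℝ) : 0 ≤ l.foldr max 0 := by
  induction l with
  | nil => simp
  | cons x l ih => exact ih.trans (le_max_right _ _)

variable [Fintype V]

theorem bid_le (a : T → ℝ) (Ts : V → Finset T) (b : V → ℝ) (B : ℝ)
    (hb : ∀ v, 0 < b v) (i : V) (L : List V) (p : ℝ)
    (h1 : ∀ X v R, L = X ++ v :: R →
      b v * margA a Ts i X.toFinset / margA a Ts v X.toFinset ≤ p)
    (h2 : (L.map b).sum + b i ≤ B → margA a Ts i L.toFinset ≤ p) (n : ℕ) :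
    ∀ (X : List V) (s : ℝ), i ∉ X → s = (X.map b).sum →
    tbsapSel a Ts b B (fun _ => b i) (Finset.univ.erase i) n X s = L →
    i ∈ tbsapSel a Ts b B b Finset.univ n X s → b i ≤ p := by
  induction n with
  | zero => intro X s hX _ _ h; exact absurd h hX
  | succ n ih =>
    intro X s hX hs hL h
    have hbud := sel_budget a Ts b B hb i _ _ X s hX h
    have hiX : i ∉ X.toFinset := by simpa using hX
    have h_final : X = L → 0 ≤ unitGain a Ts b i X.toFinset → b i ≤ p := by
      rintro rfl hg
      exact ((unitGain_nonneg a Ts b i _ hiX (hb i)).mp hg).trans (h2 (by rw [← hs]; exact hbud))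
    unfold tbsapSel at h
    split at h
    · exact absurd h hX
    rename_i w hw
    obtain ⟨hwm, hwmax⟩ := pickMax_some hw
    have hwX : w ∉ X.toFinset := by simpa using hwm
    split_ifs at h with hc
    · exact absurd h hX
    push Not at hc
    by_cases hmax : unitGain a Ts b w X.toFinset ≤ unitGain a Ts b i X.toFinset
    · have hgi := hc.1.trans hmax
      unfold tbsapSel at hL
      split at hL
      · exact h_final hL hgi
      rename_i v hv
      obtain ⟨hvm, -⟩ := pickMax_some hv
      have hvX : v ∉ X.toFinset := (Finset.mem_sdiff.mp hvm).2
      split_ifs at hL with hc'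
      · exact h_final hL hgi
      push Not at hc'
      obtain ⟨R, hR⟩ := sel_prefix a Ts b B (fun _ => b i) (Finset.univ.erase i) n (X ++ [v]) (s + b v)
      have hcand := h1 X v R (by rw [← hL, hR]; simp)
      refine le_trans ?_ hcand
      have hAv : b v ≤ _ := (unitGain_nonneg a Ts b v _ hvX (hb v)).mp hc'.1
      have hle := (hwmax v (by simpa using hvX)).trans hmax
      rw [unitGain_eq a Ts b v _ hvX, unitGain_eq a Ts b i _ hiX,
        div_le_div_iff₀ (hb v) (hb i)] at hle
      rw [le_div_iff₀ (lt_of_lt_of_le (hb v) hAv)]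
      linarith
    · push Not at hmax
      have hp := pickMax_erase (f := fun v => unitGain a Ts b v X.toFinset)
        (g := fun v => unitGain a Ts b v X.toFinset) (i := i) X.toFinset
        (fun _ _ _ => rfl) w hwX hmax
      rw [hw] at hp
      have hwi : i ≠ w := by
        rintro rfl
        exact lt_irrefl _ hmax
      unfold tbsapSel at hL
      rw [← hp] at hL
      simp only at hL
      rw [if_neg (by push Not; exact ⟨hc.1, hbud⟩)] at hL
      exact ih (X ++ [w]) (s + b w) (by simp [hX, hwi]) (by simp [hs]) hL h

theorem not_win (a : T → ℝ) (Ts : V → Finset T) (b : V → ℝ) (B : ℝ)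
    (hb : ∀ v, 0 < b v) (i : V) (L : List V) (p b' : ℝ) (hpb : p < b') (hbb : b i ≤ b')
    (h1 : ∀ X v R, L = X ++ v :: R →
      b v * margA a Ts i X.toFinset / margA a Ts v X.toFinset ≤ p)
    (h2 : (L.map b).sum + b i ≤ B → margA a Ts i L.toFinset ≤ p) (n : ℕ) :
    ∀ (X : List V) (s : ℝ), i ∉ X → s = (X.map b).sum →
    tbsapSel a Ts b B (fun _ => b i) (Finset.univ.erase i) n X s = L →
    i ∉ tbsapSel a Ts (Function.update b i b') B (Function.update b i b') Finset.univ n X s := by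
  have hb0 : 0 < b' := lt_of_lt_of_le (hb i) hbb
  have hub : ∀ v, 0 < Function.update b i b' v := by
    intro v
    by_cases h : v = i
    · subst h; simpa using hb0
    · simpa [h] using hb v
  induction n with
  | zero => intro X s hX _ _ h; exact absurd h hX
  | succ n ih =>
    intro X s hX hs hL h
    have hbud := sel_budget a Ts _ B hub i _ _ X s hX h
    simp only [Function.update_self] at hbud
    have hiX : i ∉ X.toFinset := by simpa using hX
    have hgain : ∀ y, y ∉ X.toFinset → y ≠ i →
        unitGain a Ts (Function.update b i b') y X.toFinset = unitGain a Ts b y X.toFinset := by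
      intro y hy hyi
      rw [unitGain_eq _ _ _ _ _ hy, unitGain_eq _ _ _ _ _ hy, Function.update_of_ne hyi]
    have hneg : X = L → unitGain a Ts (Function.update b i b') i X.toFinset < 0 := by
      rintro rfl
      have := h2 (by rw [← hs]; linarith)
      rw [← not_le, unitGain_nonneg a Ts _ i _ hiX (hub i), Function.update_self]
      linarith
    unfold tbsapSel at h
    split at h
    · exact absurd h hX
    rename_i w hw
    obtain ⟨hwm, hwmax⟩ := pickMax_some hw
    have hwX : w ∉ X.toFinset := by simpa using hwm
    split_ifs at h with hc
    · exact absurd h hX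
    push Not at hc
    unfold tbsapSel at hL
    split at hL
    · rename_i hv
      have he := pickMax_none hv
      have hwi : w = i := by
        by_contra hne
        have : w ∈ Finset.univ.erase i \ X.toFinset := by
          rw [Finset.mem_sdiff]; exact ⟨by simp [hne], hwX⟩
        rw [he] at this
        simp at this
      rw [hwi] at hc
      exact absurd hc.1 (not_le.mpr (hneg hL))
    rename_i v hv
    obtain ⟨hvm, hvmax⟩ := pickMax_some hv
    have hvX : v ∉ X.toFinset := (Finset.mem_sdiff.mp hvm).2
    have hvi : v ≠ i := Finset.ne_of_mem_erase (Finset.mem_sdiff.mp hvm).1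
    split_ifs at hL with hc'
    · rcases hc' with hc' | hc'
      · by_cases hwi : w = i
        · rw [hwi] at hc
          exact absurd hc.1 (not_le.mpr (hneg hL))
        · have h3 := hvmax w (by rw [Finset.mem_sdiff]; exact ⟨by simp [hwi], hwX⟩)
          have h4 := hc.1
          rw [hgain w hwX hwi] at h4
          linarith
      · linarith
    push Not at hc'
    obtain ⟨R, hR⟩ := sel_prefix a Ts b B (fun _ => b i) (Finset.univ.erase i) n (X ++ [v]) (s + b v)
    have hcand := h1 X v R (by rw [← hL, hR]; simp)
    have hAv : b v ≤ _ := (unitGain_nonneg a Ts b v _ hvX (hb v)).mp hc'.1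
    have hlt : unitGain a Ts (Function.update b i b') i X.toFinset
        < unitGain a Ts (Function.update b i b') v X.toFinset := by
      rw [hgain v hvX hvi, unitGain_eq _ _ _ _ _ hvX, unitGain_eq _ _ _ _ _ hiX,
        Function.update_self, div_lt_div_iff₀ hb0 (hb v)]
      have := lt_of_le_of_lt hcand hpb
      rw [div_lt_iff₀ (lt_of_lt_of_le (hb v) hAv)] at this
      linarith
    have hp := pickMax_erase (f := fun v => unitGain a Ts (Function.update b i b') v X.toFinset)
        (g := fun v => unitGain a Ts b v X.toFinset) (i := i) X.toFinset hgain v hvX hlt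
    rw [hw, hv] at hp
    obtain rfl : w = v := by simpa using hp
    rw [Function.update_of_ne hvi] at h
    exact ih (X ++ [w]) (s + b w) (by simp [hX, Ne.symm hvi]) (by simp [hs]) hL h

end

/-- critical payment property of TBSAP: with task sets and the
other vehicles' bids fixed, if `v_i` is a winner and `p_i` is its TBSAP payment,
then for any bid `b°_i > p_i`, `v_i` is not in the winner set of the TBSAP
winner allocation stage — `p_i` is the maximum bid with which `v_i` can win. -/
theorem tbsap_critical_payment {V T : Type} [Fintype V] [DecidableEq V] [DecidableEq T]
    (a : T → ℝ) (Ts : V → Finset T) (b : V → ℝ) (B : ℝ)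
    (ha : ∀ t, 0 < a t) (hb : ∀ i, 0 < b i) (hB : 0 < B)
    (i : V) (hwin : i ∈ tbsapWinners a Ts b B)
    (b' : ℝ) (hb' : tbsapPayment a Ts b B i < b') :
    i ∉ tbsapWinners a Ts (Function.update b i b') B := by
  have h1 : ∀ X v R, tbsapPaymentList a Ts b B i = X ++ v :: R →
      b v * margA a Ts i X.toFinset / margA a Ts v X.toFinset ≤ tbsapPayment a Ts b B i := by
    intro X v R h
    have hm := cand_mem a Ts b i v R X ∅
    rw [← h, Finset.empty_union] at hm
    unfold tbsapPayment
    apply le_foldr_max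
    split_ifs
    · exact List.mem_cons_of_mem _ hm
    · exact hm
  have h2 : ((tbsapPaymentList a Ts b B i).map b).sum + b i ≤ B →
      margA a Ts i (tbsapPaymentList a Ts b B i).toFinset ≤ tbsapPayment a Ts b B i := by
    intro h
    unfold tbsapPayment
    apply le_foldr_max
    rw [if_pos h]
    exact List.mem_cons_self
  have hle := bid_le a Ts b B hb i _ _ h1 h2 (Fintype.card V) [] 0 (by simp) (by simp) rfl hwin
  exact not_win a Ts b B hb i _ _ b' hb' (hle.trans hb'.le) h1 h2 (Fintype.card V) [] 0
    (by simp) (by simp) rfl
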